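/- Fix a constant c > 0. For T > e^e and W > 1 define x(T) := log T, X(T) := T·log T, b(T, W) := 1 − c/log(x(T)·W), and S(T, W) := (X(T)/W)·(log X(T))³ + (X(T)/W)·(log W)⁶ + X(T)^{b(T,W)}·(log W)⁵. Then for every increasing function W : (e^e, ∞) → (1, ∞) there exists k > 0 such that it is NOT the case that S(T, W(T)) = o(log T · T^{1 − k/log log T}) as T → ∞. -/

import Mathlib

/-- `S(T, W) = (X/W)(log X)³ + (X/W)(log W)⁶ + X^{b}(log W)⁵` with `X = T log T` and
`b = 1 − c/log(log T · W)` (here `x(T) = log T`). -/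
noncomputable def Sfun (c T W : ℝ) : ℝ :=
  (T * Real.log T / W) * (Real.log (T * Real.log T)) ^ 3 +
    (T * Real.log T / W) * (Real.log W) ^ 6 +
    (T * Real.log T) ^ (1 - c / Real.log (Real.log T * W)) * (Real.log W) ^ 5

/-- A pointwise lower bound for `Sfun` with `k = 2c`, valid for every value `W > 1`: either `W` is
so small that the first summand is large, or `W` is so large that the third one is. -/
theorem le_Sfun_of_sq_log_log_le {c T W : ℝ} (hc : 0 < c) (hT : 0 < T) (hW : 1 < W)
    (hl : 1 ≤ Real.log (Real.log T))
    (hsq : Real.log (Real.log T) ^ 2 ≤ 2 * c * Real.log T) (hL : 0 < Real.log T) :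
    Real.log T * T ^ (1 - 2 * c / Real.log (Real.log T)) ≤ Sfun c T W := by
  have hlogX : Real.log (T * Real.log T) = Real.log T + Real.log (Real.log T) :=
    Real.log_mul hT.ne' hL.ne'
  have hlL : Real.log (Real.log T) ≤ Real.log T := Real.log_le_self hL.le
  have hexpl : Real.exp (Real.log (Real.log T)) = Real.log T := Real.exp_log hL
  have hexpL : Real.exp (Real.log T) = T := Real.exp_log hT
  have hpow : T ^ (1 - 2 * c / Real.log (Real.log T)) =
      T / Real.exp (2 * c * Real.log T / Real.log (Real.log T)) := by
    rw [Real.rpow_def_of_pos hT, show Real.log T * (1 - 2 * c / Real.log (Real.log T)) =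
      Real.log T - 2 * c * Real.log T / Real.log (Real.log T) by ring, Real.exp_sub, hexpL]
  have hXpow : (T * Real.log T) ^ (1 - c / Real.log (Real.log T * W)) =
      Real.exp ((Real.log T + Real.log (Real.log T)) *
        (1 - c / Real.log (Real.log T * W))) := by
    rw [Real.rpow_def_of_pos (mul_pos hT hL), hlogX]
  have hlogLW : Real.log (Real.log T * W) = Real.log (Real.log T) + Real.log W :=
    Real.log_mul hL.ne' (by linarith)
  have hlogW : 0 < Real.log W := Real.log_pos hW
  unfold Sfun
  rw [hpow, hXpow, hlogX, hlogLW]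
  set L := Real.log T
  set l := Real.log L
  have hl0 : 0 < l := by linarith
  have hW0 : 0 < W := by linarith
  have hlq : l ≤ 2 * c * L / l := by
    rw [le_div_iff₀ hl0]
    nlinarith
  set q := 2 * c * L / l with hq
  have hLE : L ≤ Real.exp q := hexpl ▸ Real.exp_le_exp.2 hlq
  have h2 : 0 ≤ T * L / W * Real.log W ^ 6 := by positivity
  rcases le_or_gt W (Real.exp q) with hWE | hWE
  · have h3 : 0 ≤ Real.exp ((L + l) * (1 - c / (l + Real.log W))) * Real.log W ^ 5 := by
      positivity
    have h1 : L * (T / Real.exp q) ≤ T * L / W * (L + l) ^ 3 :=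
      calc L * (T / Real.exp q) = T * L / Real.exp q := by ring
        _ ≤ T * L / W := by gcongr
        _ ≤ T * L / W * (L + l) ^ 3 :=
          le_mul_of_one_le_right (by positivity) (one_le_pow₀ (by linarith))
    linarith
  · have h1 : 0 ≤ T * L / W * (L + l) ^ 3 := by positivity
    have hqW : q ≤ Real.log W := ((Real.lt_log_iff_exp_lt hW0).2 hWE).le
    have hLl : L ≤ (L + l) * (1 - c / (l + Real.log W)) := by
      have hd : (L + l) * (c / (l + Real.log W)) ≤ l := by
        have hlW : 2 * c * L ≤ Real.log W * l := (div_le_iff₀ hl0).1 hqW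
        rw [← mul_div_assoc, div_le_iff₀ (by linarith)]
        nlinarith
      linarith
    have h3 : L * (T / Real.exp q) ≤
        Real.exp ((L + l) * (1 - c / (l + Real.log W))) * Real.log W ^ 5 :=
      calc L * (T / Real.exp q) = T * (L / Real.exp q) := by ring
        _ ≤ T * 1 := by
          gcongr
          exact (div_le_one (Real.exp_pos q)).2 hLE
        _ = Real.exp L * 1 := by rw [hexpL]
        _ ≤ Real.exp ((L + l) * (1 - c / (l + Real.log W))) * Real.log W ^ 5 := by
          gcongr
          exact one_le_pow₀ (by linarith)
    linarith

/-- Fix `c > 0`. For every increasing `W : (e^e, ∞) → (1, ∞)` there exists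
`k > 0` such that it is NOT the case that
`S(T, W(T)) = o(log T · T^{1 − k/log log T})` as `T → ∞`. -/
theorem no_W_for_banks_interval
    (c : ℝ) (hc : 0 < c) (W : ℝ → ℝ)
    (hW1 : ∀ T : ℝ, Real.exp (Real.exp 1) < T → 1 < W T)
    (hWmono : MonotoneOn W (Set.Ioi (Real.exp (Real.exp 1)))) :
    ∃ k : ℝ, 0 < k ∧
      ¬ Filter.Tendsto
          (fun T : ℝ => Sfun c T (W T) /
            (Real.log T * T ^ (1 - k / Real.log (Real.log T))))
          Filter.atTop (nhds 0) := by
  refine ⟨2 * c, by positivity, fun h => ?_⟩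
  have hL := Real.tendsto_log_atTop
  have hl := hL.comp hL
  have hsq : ∀ᶠ x : ℝ in Filter.atTop, x ^ 2 ≤ 2 * c * Real.exp x := by
    have := (Real.isLittleO_pow_exp_atTop (n := 2)).bound (show 0 < 2 * c by positivity)
    filter_upwards [this] with x hx
    simpa using hx
  have hlt : ∀ᶠ T : ℝ in Filter.atTop, Sfun c T (W T) /
      (Real.log T * T ^ (1 - 2 * c / Real.log (Real.log T))) < 1 :=
    h.eventually (gt_mem_nhds one_pos)
  obtain ⟨T, hT1, hT, hLT, hlT, hsqT⟩ := (hlt.and ((Filter.eventually_gt_atTop (Real.exp (Real.exp 1))).and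
    ((hL.eventually_gt_atTop 0).and ((hl.eventually_ge_atTop 1).and (hl.eventually hsq))))).exists
  have hT0 : 0 < T := (Real.exp_pos _).trans hT
  simp only [Function.comp_apply, Real.exp_log hLT] at hlT hsqT
  rw [div_lt_one (mul_pos hLT (Real.rpow_pos_of_pos hT0 _))] at hT1
  exact hT1.not_ge (le_Sfun_of_sq_log_log_le hc hT0 (hW1 T hT) hlT hsqT hLT)
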